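/- Let T be a tiling of the Euclidean plane by convex polygons that is monocoronal up to congruence, in which every vertex x is contained in exactly n + 1 tiles: x is an extreme point of exactly n of them, having a_1, …, a_n extreme points respectively (a_i ≥ 3, the same multiset for every vertex), while x lies on the boundary of the remaining tile without being one of its extreme points. Then ∑_{i=1}^{n} 1/a_i = (n − 1)/2 (as real numbers). -/

import Mathlib

noncomputable section

open Set

abbrev E2 := EuclideanSpace ℝ (Fin 2)

/-- A convex polygon: a compact convex subset of the plane with nonempty interior
and finitely many extreme points. -/
def IsConvexPolygon (P : Set E2) : Prop :=
  IsCompact P ∧ Convex ℝ P ∧ (interior P).Nonempty ∧ (Set.extremePoints ℝ P).Finite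

/-- A tiling of the plane by convex polygons. -/
def IsTiling (T : Set (Set E2)) : Prop :=
  T.Countable ∧ (∀ P ∈ T, IsConvexPolygon P) ∧ (⋃₀ T = Set.univ) ∧
    T.Pairwise fun P Q => Disjoint (interior P) (interior Q)

/-- A vertex of a tiling: an extreme point of at least one tile. -/
def IsVertex (T : Set (Set E2)) (x : E2) : Prop :=
  ∃ P ∈ T, x ∈ Set.extremePoints ℝ P

/-- An isometry of the plane is orientation preserving if its linear part has
determinant `1`. -/
def OrientationPreserving (f : E2 ≃ᵃⁱ[ℝ] E2) : Prop :=
  LinearMap.det (f.linearIsometryEquiv.toLinearEquiv : E2 →ₗ[ℝ] E2) = 1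

/-- Monocoronal up to rigid motions: any two vertex coronae are directly congruent. -/
def MonocoronalRM (T : Set (Set E2)) : Prop :=
  ∀ x y : E2, IsVertex T x → IsVertex T y →
    ∃ f : E2 ≃ᵃⁱ[ℝ] E2, OrientationPreserving f ∧ f x = y ∧
      (fun P => f '' P) '' {P | P ∈ T ∧ x ∈ P} = {P | P ∈ T ∧ y ∈ P}

/-- Monocoronal up to congruence: any two vertex coronae are congruent
(mirror images allowed). -/
def MonocoronalC (T : Set (Set E2)) : Prop :=
  ∀ x y : E2, IsVertex T x → IsVertex T y →
    ∃ f : E2 ≃ᵃⁱ[ℝ] E2, f x = y ∧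
      (fun P => f '' P) '' {P | P ∈ T ∧ x ∈ P} = {P | P ∈ T ∧ y ∈ P}

/-- A symmetry of a tiling: an isometry mapping the set of tiles onto itself. -/
def IsSymmetry (T : Set (Set E2)) (f : E2 ≃ᵃⁱ[ℝ] E2) : Prop :=
  (fun P => f '' P) '' T = T

/-- The set of translation vectors of a tiling. -/
def periodVectors (T : Set (Set E2)) : Set E2 :=
  {v | IsSymmetry T (AffineIsometryEquiv.constVAdd ℝ E2 v)}

open MeasureTheory

/-- The symplectic form `w 0 * v 1 - w 1 * v 0`, as a functional of `v`. -/
def omL (w : E2) : E2 →L[ℝ] ℝ :=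
  (w 0) • (EuclideanSpace.proj 1 : E2 →L[ℝ] ℝ) - (w 1) • (EuclideanSpace.proj 0 : E2 →L[ℝ] ℝ)

lemma omL_apply (w v : E2) : omL w v = w 0 * v 1 - w 1 * v 0 := by
  simp [omL]

lemma omL_symm (w v : E2) : omL w v = - omL v w := by
  simp only [omL_apply]; ring

lemma omL_self (w : E2) : omL w w = 0 := by
  simp only [omL_apply]; ring

/-- Rotation by a right angle. -/
def rotJ (w : E2) : E2 := !₂[- w 1, w 0]

lemma omL_rotJ (w : E2) : omL w (rotJ w) = w 0 ^ 2 + w 1 ^ 2 := by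
  simp only [omL_apply, rotJ]; simp; ring

lemma sq_pos_of_ne {w : E2} (hw : w ≠ 0) : 0 < w 0 ^ 2 + w 1 ^ 2 := by
  by_contra h
  have h0 : w 0 = 0 := by nlinarith [sq_nonneg (w 0), sq_nonneg (w 1)]
  have h1 : w 1 = 0 := by nlinarith [sq_nonneg (w 0), sq_nonneg (w 1)]
  apply hw
  ext i
  fin_cases i <;> simp [h0, h1]

lemma omL_ne_zero {w : E2} (hw : w ≠ 0) : omL w ≠ 0 := by
  intro h
  have := omL_rotJ w
  rw [h] at this
  simp only [zero_apply] at this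
  linarith [sq_pos_of_ne hw]

/-- Cramer's rule. -/
lemma omL_cramer (v k w : E2) : (omL v k) • w = (omL w k) • v + (omL v w) • k := by
  ext i
  fin_cases i <;> simp [omL_apply] <;> ring

lemma null_ker (f : E2 →L[ℝ] ℝ) (hf : f ≠ 0) : (volume : Measure E2) {w | f w = 0} = 0 := by
  have h := Measure.addHaar_submodule (volume : Measure E2) (LinearMap.ker (f : E2 →ₗ[ℝ] ℝ)) (by
    intro h
    apply hf
    ext w
    have : w ∈ LinearMap.ker (f : E2 →ₗ[ℝ] ℝ) := by rw [h]; trivial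
    simpa using this)
  exact h

/-- The tangent cone of `P` at `x`. -/
def tcone (P : Set E2) (x : E2) : Set E2 := {v | ∃ t : ℝ, 0 < t ∧ x + t • v ∈ P}

/-- The (rotated) normal cone of `P` at `x`. -/
def ncone (P : Set E2) (x : E2) : Set E2 := {w | ∀ p ∈ P, omL w (p - x) ≤ 0}

/-- The unit disc. -/
def uB : Set E2 := Metric.ball 0 1

lemma uB_fin (s : Set E2) : (volume : Measure E2) (s ∩ uB) ≠ ⊤ :=
  ((measure_mono inter_subset_right).trans_lt measure_ball_lt_top).ne

lemma uB_pos : 0 < (volume : Measure E2).real uB :=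
  ENNReal.toReal_pos (Metric.measure_ball_pos _ _ one_pos).ne' measure_ball_lt_top.ne

lemma tcone_shrink {P : Set E2} (hP : Convex ℝ P) {x : E2} (hx : x ∈ P) {v : E2} {t s : ℝ}
    (hs : 0 < s) (hst : s ≤ t) (h : x + t • v ∈ P) : x + s • v ∈ P := by
  have ht : 0 < t := hs.trans_le hst
  have := hP hx h (a := 1 - s / t) (b := s / t)
    (by rw [sub_nonneg, div_le_one ht]; exact hst) (by positivity) (by ring)
  convert this using 1
  rw [smul_add, smul_smul, div_mul_cancel₀ _ ht.ne']
  module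

lemma tcone_smul {P : Set E2} {x v : E2} (h : v ∈ tcone P x) {c : ℝ} (hc : 0 < c) :
    c • v ∈ tcone P x := by
  obtain ⟨t, ht, h⟩ := h
  refine ⟨t / c, by positivity, ?_⟩
  rwa [smul_smul, div_mul_cancel₀ _ hc.ne']

lemma tcone_add {P : Set E2} (hP : Convex ℝ P) {x : E2} (hx : x ∈ P) {v w : E2}
    (hv : v ∈ tcone P x) (hw : w ∈ tcone P x) : v + w ∈ tcone P x := by
  obtain ⟨t, ht, h⟩ := hv
  obtain ⟨s, hs, h'⟩ := hw
  have hm : 0 < min t s := lt_min ht hs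
  have h1 := tcone_shrink hP hx hm (min_le_left _ _) h
  have h2 := tcone_shrink hP hx hm (min_le_right _ _) h'
  refine ⟨min t s / 2, by positivity, ?_⟩
  have := hP h1 h2 (a := 1/2) (b := 1/2) (by norm_num) (by norm_num) (by norm_num)
  convert this using 1
  module

lemma tcone_zero {P : Set E2} {x : E2} (hx : x ∈ P) : (0 : E2) ∈ tcone P x :=
  ⟨1, one_pos, by simpa using hx⟩

lemma tcone_convex {P : Set E2} (hP : Convex ℝ P) {x : E2} (hx : x ∈ P) :
    Convex ℝ (tcone P x) := by
  intro v hv w hw a b ha hb hab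
  have key : ∀ {c : ℝ} {u : E2}, 0 ≤ c → u ∈ tcone P x → c • u ∈ tcone P x := by
    intro c u hc hu
    rcases hc.eq_or_lt with rfl | hc
    · rw [zero_smul]; exact tcone_zero hx
    · exact tcone_smul hu hc
  exact tcone_add hP hx (key ha hv) (key hb hw)

lemma mem_tcone_of_mem {P : Set E2} {x p : E2} (hp : p ∈ P) : p - x ∈ tcone P x :=
  ⟨1, one_pos, by simpa using hp⟩

lemma tcone_eq_iUnion {P : Set E2} (hP : Convex ℝ P) {x : E2} (hx : x ∈ P) :
    tcone P x = ⋃ m : ℕ, {v : E2 | x + ((1 : ℝ) / (m + 1)) • v ∈ P} := by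
  ext v
  simp only [mem_iUnion, mem_ofPred_eq]
  constructor
  · rintro ⟨t, ht, h⟩
    obtain ⟨m, hm⟩ := exists_nat_one_div_lt ht
    exact ⟨m, tcone_shrink hP hx (by positivity) hm.le h⟩
  · rintro ⟨m, h⟩
    exact ⟨_, by positivity, h⟩

lemma tcone_measurable {P : Set E2} (hP : Convex ℝ P) (hc : IsClosed P) {x : E2} (hx : x ∈ P) :
    MeasurableSet (tcone P x) := by
  rw [tcone_eq_iUnion hP hx]
  refine MeasurableSet.iUnion fun m => IsClosed.measurableSet ?_
  exact hc.preimage (f := fun v : E2 => x + ((1 : ℝ) / (m + 1)) • v) (by fun_prop)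

lemma ncone_measurable (P : Set E2) (x : E2) : MeasurableSet (ncone P x) := by
  apply IsClosed.measurableSet
  have : ncone P x = ⋂ p ∈ P, {w | omL w (p - x) ≤ 0} := by
    ext w; simp [ncone]
  rw [this]
  refine isClosed_biInter fun p _ => ?_
  refine isClosed_le ?_ continuous_const
  simp only [omL_apply]
  fun_prop

lemma ncone_iff {P : Set E2} {x w : E2} : w ∈ ncone P x ↔ ∀ k ∈ tcone P x, omL w k ≤ 0 := by
  constructor
  · rintro h k ⟨t, ht, hk⟩
    have := h _ hk
    rw [add_sub_cancel_left, map_smul, smul_eq_mul] at this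
    by_contra hh
    push Not at hh
    nlinarith [mul_pos ht hh]
  · intro h p hp
    exact h _ (mem_tcone_of_mem hp)

lemma null_homothety {N : Set E2} (hN : (volume : Measure E2) N = 0) (x : E2) {r : ℝ}
    (hr : r ≠ 0) : (volume : Measure E2) {v : E2 | x + r • v ∈ N} = 0 := by
  have h1 := Measure.addHaar_preimage_smul (volume : Measure E2) hr ((fun v => x + v) ⁻¹' N)
  rw [measure_preimage_add, hN, mul_zero] at h1
  exact h1

lemma null_inter {P Q : Set E2} (hP : Convex ℝ P) (hQ : Convex ℝ Q)
    (hd : Disjoint (interior P) (interior Q)) : (volume : Measure E2) (P ∩ Q) = 0 := by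
  refine measure_mono_null (t := frontier P ∪ frontier Q) ?_
    (measure_union_null (hP.addHaar_frontier volume) (hQ.addHaar_frontier volume))
  rintro z ⟨h1, h2⟩
  by_cases hz : z ∈ interior P
  · exact Or.inr ⟨subset_closure h2, fun h => disjoint_left.1 hd hz h⟩
  · exact Or.inl ⟨subset_closure h1, hz⟩

lemma tcone_null_inter {P Q : Set E2} (hP : Convex ℝ P) (hQ : Convex ℝ Q)
    (hd : Disjoint (interior P) (interior Q)) {x : E2} (hxP : x ∈ P) (hxQ : x ∈ Q) :
    (volume : Measure E2) (tcone P x ∩ tcone Q x) = 0 := by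
  refine measure_mono_null (t := ⋃ m : ℕ, {v : E2 | x + ((1 : ℝ) / (m + 1)) • v ∈ P ∩ Q}) ?_ ?_
  · rintro v ⟨⟨t, ht, h⟩, ⟨s, hs, h'⟩⟩
    obtain ⟨m, hm⟩ := exists_nat_one_div_lt (lt_min ht hs)
    rw [mem_iUnion]
    exact ⟨m, tcone_shrink hP hxP (by positivity) (hm.le.trans (min_le_left _ _)) h,
      tcone_shrink hQ hxQ (by positivity) (hm.le.trans (min_le_right _ _)) h'⟩
  · rw [measure_iUnion_null_iff]
    intro m
    exact null_homothety (null_inter hP hQ hd) x (by positivity)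

lemma half_measure {U : Set E2} (hU : MeasurableSet U) (h1 : U ∪ (-U) = univ)
    (h2 : (volume : Measure E2) (U ∩ (-U)) = 0) :
    2 * (volume : Measure E2).real (U ∩ uB) = (volume : Measure E2).real uB := by
  have e : uB = (U ∩ uB) ∪ ((-U) ∩ uB) := by
    rw [← union_inter_distrib_right, h1, univ_inter]
  have hneg : (volume : Measure E2) ((-U) ∩ uB) = (volume : Measure E2) (U ∩ uB) := by
    rw [← Measure.measure_neg (volume : Measure E2) (U ∩ uB)]
    congr 1
    ext z
    simp [uB]
  have hB : MeasurableSet uB := measurableSet_ball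
  have := measureReal_union₀ (μ := (volume : Measure E2)) (s := U ∩ uB) (t := (-U) ∩ uB)
    (hU.neg.inter hB).nullMeasurableSet
    (measure_mono_null (by
      rintro z ⟨⟨h, _⟩, ⟨h', _⟩⟩
      exact ⟨h, h'⟩) h2) (uB_fin _) (uB_fin _)
  rw [← e] at this
  rw [this]
  simp only [Measure.real, hneg]
  ring

lemma pointed {P : Set E2} (hP : Convex ℝ P) {x : E2} (hx : x ∈ extremePoints ℝ P) {k : E2}
    (h : k ∈ tcone P x) (h' : -k ∈ tcone P x) : k = 0 := by
  obtain ⟨t, ht, h⟩ := h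
  obtain ⟨s, hs, h'⟩ := h'
  have hm : 0 < min t s := lt_min ht hs
  have h1 := tcone_shrink hP hx.1 hm (min_le_left _ _) h
  have h2 := tcone_shrink hP hx.1 hm (min_le_right _ _) h'
  have := hx.2 h1 h2 ⟨1/2, 1/2, by norm_num, by norm_num, by norm_num, by module⟩
  have h3 : (min t s) • k = 0 := by simpa using this
  rcases smul_eq_zero.1 h3 with h | h
  · exact absurd h hm.ne'
  · exact h

/-- An interior direction of the tangent cone which is nonzero sees the cone on both sides. -/
lemma both_sides {K : Set E2} {w : E2} (hw : w ∈ interior K) (h0 : w ≠ 0) :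
    (∃ k ∈ K, 0 < omL w k) ∧ (∃ k ∈ K, omL w k < 0) := by
  have hpos := sq_pos_of_ne h0
  have hcont : ∀ c : ℝ, ∃ t : ℝ, 0 < t ∧ w + (t * c) • rotJ w ∈ K := by
    intro c
    have hc : Filter.Tendsto (fun t : ℝ => w + (t * c) • rotJ w) (nhdsWithin 0 (Ioi 0))
        (nhds w) := by
      have : Continuous (fun t : ℝ => w + (t * c) • rotJ w) := by fun_prop
      have h := this.tendsto 0
      simp only [zero_mul, zero_smul, add_zero] at h
      exact h.mono_left nhdsWithin_le_nhds
    have := (hc.eventually (mem_interior_iff_mem_nhds.1 hw)).and self_mem_nhdsWithin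
    obtain ⟨t, h1, h2⟩ := this.exists
    exact ⟨t, h2, h1⟩
  constructor
  · obtain ⟨t, ht, h⟩ := hcont 1
    refine ⟨_, h, ?_⟩
    rw [map_add, map_smul, omL_self, omL_rotJ, smul_eq_mul]
    nlinarith [mul_pos ht hpos]
  · obtain ⟨t, ht, h⟩ := hcont (-1)
    refine ⟨_, h, ?_⟩
    rw [map_add, map_smul, omL_self, omL_rotJ, smul_eq_mul]
    nlinarith [mul_pos ht hpos]

lemma omL_neg (w v : E2) : omL (-w) v = - omL w v := by
  simp only [omL_apply]; simp; ring

lemma extreme_angle {P : Set E2} (hP : Convex ℝ P) (hc : IsClosed P)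
    (hi : (interior P).Nonempty) {x : E2} (hx : x ∈ extremePoints ℝ P) :
    (volume : Measure E2).real (tcone P x ∩ uB) + (volume : Measure E2).real (ncone P x ∩ uB)
      = (volume : Measure E2).real uB / 2 := by
  set K := tcone P x with hK
  set N := ncone P x with hN
  have hKm : MeasurableSet K := tcone_measurable hP hc hx.1
  have hNm : MeasurableSet N := ncone_measurable P x
  have hB : MeasurableSet uB := measurableSet_ball
  have hfr : (volume : Measure E2) (frontier K) = 0 := (tcone_convex hP hx.1).addHaar_frontier volume
  have h0 : (volume : Measure E2) {(0 : E2)} = 0 := measure_singleton _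
  have hKN : K ∩ N ⊆ frontier K ∪ {0} := by
    rintro w ⟨h1, h2⟩
    by_cases hw : w = 0
    · exact Or.inr hw
    refine Or.inl ⟨subset_closure h1, fun h => ?_⟩
    obtain ⟨k, hk, hpos⟩ := (both_sides h hw).1
    linarith [ncone_iff.1 h2 k hk]
  have hKN' : K ∩ (-N) ⊆ frontier K ∪ {0} := by
    rintro w ⟨h1, h2⟩
    by_cases hw : w = 0
    · exact Or.inr hw
    refine Or.inl ⟨subset_closure h1, fun h => ?_⟩
    obtain ⟨k, hk, hneg⟩ := (both_sides h hw).2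
    have := ncone_iff.1 h2 k hk
    rw [omL_neg] at this
    linarith
  have hn0 : (volume : Measure E2) (frontier K ∪ {0}) = 0 := measure_union_null hfr h0
  have hKK : K ∩ (-K) ⊆ {0} := by
    rintro w ⟨h1, h2⟩
    exact pointed hP hx h1 h2
  have hNN : N ∩ (-N) ⊆ {0} := by
    rintro w ⟨h1, h2⟩
    by_contra hw
    obtain ⟨p, hp⟩ := hi
    have hz : ∀ q ∈ P, omL w (q - x) = 0 := by
      intro q hq
      have a1 := h1 q hq
      have a2 := h2 q hq
      rw [omL_neg] at a2
      linarith
    have hz' : interior P ⊆ {q | omL w q = omL w x} := by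
      intro q hq
      have := hz q (interior_subset hq)
      rw [map_sub] at this
      exact sub_eq_zero.1 this
    obtain ⟨⟨k, hk, hpos⟩, ⟨k', hk', hneg⟩⟩ : (∃ k ∈ P, omL w x < omL w k) ∧
        ∃ k ∈ P, omL w k < omL w x := by
      exfalso
      have h3 : interior P ⊆ (fun q => q + (-x)) ⁻¹' {q | omL w q = 0} := by
        intro q hq
        have := hz q (interior_subset hq)
        simpa [sub_eq_add_neg] using this
      have h4 : (volume : Measure E2) (interior P) = 0 := measure_mono_null h3 (by
        rw [measure_preimage_add_right]
        exact null_ker _ (omL_ne_zero hw))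
      exact (isOpen_interior.measure_pos (volume : Measure E2) ⟨p, hp⟩).ne' h4
    have := hz k hk
    rw [map_sub] at this
    linarith
  have hcov : ∀ w, w ∈ K ∨ w ∈ N ∨ -w ∈ K ∨ -w ∈ N := by
    intro w
    by_contra hcon
    push Not at hcon
    obtain ⟨c1, c2, c3, c4⟩ := hcon
    rw [hN, ncone_iff] at c2 c4
    push Not at c2 c4
    obtain ⟨k, hk, hpos⟩ := c2
    obtain ⟨l, hl, hneg⟩ := c4
    rw [omL_neg] at hneg
    have hneg' : 0 < - omL w l := hneg
    -- the positive combination on the line spanned by `w`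
    set m := (- omL w l) • k + (omL w k) • l with hm
    have hmK : m ∈ K := tcone_add hP hx.1 (tcone_smul hk hneg') (tcone_smul hl hpos)
    have hcr := omL_cramer l k w
    have e : m = (omL l k) • w := by
      rw [hcr, hm, omL_symm l w, add_comm]
    rcases lt_trichotomy (omL l k) 0 with h | h | h
    · apply c3
      have := tcone_smul hmK (c := -(omL l k)⁻¹) (by
        have := inv_lt_zero.2 h
        linarith)
      rw [e, smul_smul, neg_mul, inv_mul_cancel₀ h.ne, neg_one_smul] at this
      exact this
    · rw [h, zero_smul] at e
      have hk0 : (- omL w l) • k = 0 := by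
        apply pointed hP hx (tcone_smul hk hneg')
        have : -((- omL w l) • k) = (omL w k) • l := by
          rw [neg_eq_iff_add_eq_zero, ← e]
        rw [this]
        exact tcone_smul hl hpos
      rcases smul_eq_zero.1 hk0 with h | h
      · linarith
      · rw [h, map_zero] at hpos
        exact lt_irrefl _ hpos
    · apply c1
      have := tcone_smul hmK (c := (omL l k)⁻¹) (by positivity)
      rw [e, smul_smul, inv_mul_cancel₀ h.ne', one_smul] at this
      exact this
  have hhalf := half_measure (U := K ∪ N) (hKm.union hNm) (by
      ext w
      simp only [mem_union, Set.mem_neg, mem_univ, iff_true]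
      rcases hcov w with h | h | h | h <;> tauto) (by
      have hneg0 : (volume : Measure E2) (-(frontier K ∪ {0})) = 0 := by
        rw [Measure.measure_neg]; exact hn0
      refine measure_mono_null
        (t := (frontier K ∪ {0}) ∪ (-(frontier K ∪ {0}))) ?_ (measure_union_null hn0 hneg0)
      rintro w ⟨h1, h2⟩
      rcases h1 with h1 | h1 <;> rcases h2 with h2 | h2
      · exact Or.inl (Or.inr (hKK ⟨h1, h2⟩))
      · exact Or.inl (hKN' ⟨h1, h2⟩)
      · exact Or.inr (hKN' ⟨h2, by simpa using h1⟩)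
      · exact Or.inl (Or.inr (hNN ⟨h1, h2⟩)))
  rw [union_inter_distrib_right, measureReal_union₀ (hNm.inter hB).nullMeasurableSet
    (measure_mono_null (by
      rintro w ⟨⟨h, _⟩, ⟨h', _⟩⟩
      exact hKN ⟨h, h'⟩) hn0) (uB_fin _) (uB_fin _)] at hhalf
  linarith

lemma straight_angle {P : Set E2} (hP : Convex ℝ P) (hc : IsClosed P)
    (hi : (interior P).Nonempty) {x : E2} (hxP : x ∈ P) (hx : x ∉ extremePoints ℝ P)
    (hfr : x ∈ frontier P) :
    (volume : Measure E2).real (tcone P x ∩ uB) = (volume : Measure E2).real uB / 2 := by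
  have hKm : MeasurableSet (tcone P x) := tcone_measurable hP hc hxP
  obtain ⟨f, hf⟩ := geometric_hahn_banach_open_point hP.interior isOpen_interior hfr.2
  obtain ⟨p0, hp0⟩ := hi
  have hfp0 := hf p0 hp0
  have hfP : ∀ p ∈ P, f p ≤ f x := by
    intro p hp
    have h1 : p ∈ closure (interior P) := by
      rw [hP.closure_interior_eq_closure_of_nonempty_interior ⟨p0, hp0⟩]
      exact subset_closure hp
    have : closure (interior P) ⊆ {q | f q ≤ f x} :=
      closure_minimal (fun q hq => (hf q hq).le)
        (isClosed_le f.continuous continuous_const)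
    exact this h1
  have hfK : ∀ k ∈ tcone P x, f k ≤ 0 := by
    rintro k ⟨t, ht, h⟩
    have := hfP _ h
    rw [map_add, map_smul, smul_eq_mul] at this
    by_contra hh
    push Not at hh
    nlinarith [mul_pos ht hh]
  have hf0 : f ≠ 0 := by
    rintro rfl
    simp at hfp0
  -- the direction of the edge
  obtain ⟨v, hv0, hv, hv'⟩ : ∃ v : E2, v ≠ 0 ∧ v ∈ tcone P x ∧ -v ∈ tcone P x := by
    rw [mem_extremePoints] at hx
    push Not at hx
    obtain ⟨y, hy, z, hz, ⟨a, b, ha, hb, hab, hxe⟩, hne⟩ := hx hxP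
    have hyx : y - x ∈ tcone P x := mem_tcone_of_mem hy
    have hzx : z - x ∈ tcone P x := mem_tcone_of_mem hz
    have hrel : a • (y - x) + b • (z - x) = 0 := by
      have : a • (y - x) + b • (z - x) = (a • y + b • z) - (a + b) • x := by module
      rw [this, hab, hxe, one_smul, sub_self]
    refine ⟨a • (y - x), ?_, tcone_smul hyx ha, ?_⟩
    · intro h
      have hy0 : y = x := by
        rcases smul_eq_zero.1 h with h | h
        · exact absurd h ha.ne'
        · exact sub_eq_zero.1 h
      have hz0 : z = x := by
        rw [h, zero_add] at hrel
        rcases smul_eq_zero.1 hrel with h | h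
        · exact absurd h hb.ne'
        · exact sub_eq_zero.1 h
      exact hne hy0 hz0
    · have : -(a • (y - x)) = b • (z - x) := by
        rw [neg_eq_iff_add_eq_zero, hrel]
      rw [this]
      exact tcone_smul hzx hb
  have hfv : f v = 0 := by
    have h1 := hfK v hv
    have h2 := hfK _ hv'
    rw [map_neg] at h2
    linarith
  have hk := mem_tcone_of_mem (x := x) (interior_subset hp0)
  set k := p0 - x with hkdef
  have hfk : f k < 0 := by rw [hkdef, map_sub]; linarith
  have hom : omL v k ≠ 0 := by
    intro h
    -- then `k` is parallel to `v`
    have h1 := omL_cramer v k (rotJ v)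
    rw [h, zero_smul, omL_rotJ] at h1
    have h2 := congrArg f h1
    rw [map_zero, map_add, map_smul, map_smul, hfv, smul_zero, zero_add, smul_eq_mul] at h2
    have := sq_pos_of_ne hv0
    nlinarith [mul_pos this (neg_pos.2 hfk)]
  have hsv : ∀ c : ℝ, c • v ∈ tcone P x := by
    intro c
    rcases lt_trichotomy c 0 with h | h | h
    · have := tcone_smul hv' (c := -c) (by linarith)
      simpa using this
    · rw [h, zero_smul]; exact tcone_zero hxP
    · exact tcone_smul hv h
  have hhalf := half_measure hKm (by
      ext w
      simp only [mem_union, Set.mem_neg, mem_univ, iff_true]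
      have hw : w = ((omL v k)⁻¹ * omL w k) • v + ((omL v k)⁻¹ * omL v w) • k := by
        rw [mul_smul, mul_smul, ← smul_add, ← omL_cramer, smul_smul, inv_mul_cancel₀ hom, one_smul]
      set α := (omL v k)⁻¹ * omL w k
      set β := (omL v k)⁻¹ * omL v w
      rcases lt_trichotomy β 0 with h | h | h
      · right
        have : -w = (-α) • v + (-β) • k := by rw [hw]; module
        rw [this]
        exact tcone_add hP hxP (hsv _) (tcone_smul hk (by linarith))
      · left
        rw [hw, h, zero_smul, add_zero]
        exact hsv _
      · left
        rw [hw]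
        exact tcone_add hP hxP (hsv _) (tcone_smul hk h)) (by
      refine measure_mono_null (t := {w | f w = 0}) ?_ (null_ker f hf0)
      rintro w ⟨h1, h2⟩
      have a1 := hfK _ h1
      have a2 := hfK _ h2
      rw [map_neg] at a2
      exact le_antisymm a1 (by linarith))
  linarith

lemma exterior_angle_sum {P : Set E2} (hc : IsCompact P) (hne : P.Nonempty)
    (hfin : (extremePoints ℝ P).Finite) :
    ∑ x ∈ hfin.toFinset, (volume : Measure E2).real (ncone P x ∩ uB)
      = (volume : Measure E2).real uB := by
  have hB : MeasurableSet uB := measurableSet_ball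
  rw [← measureReal_biUnion_finset₀ (μ := (volume : Measure E2)) (s := hfin.toFinset)
    (f := fun x => ncone P x ∩ uB) (h := fun _ _ => uB_fin _)]
  · congr 1
    rw [← iUnion₂_inter, inter_eq_right]
    intro w _
    simp only [mem_iUnion, Finite.mem_toFinset, exists_prop]
    have hex : IsExposed ℝ P ((omL w).toExposed P) := ContinuousLinearMap.toExposed.isExposed
    have hcomp : IsCompact ((omL w).toExposed P) := hex.isCompact hc
    obtain ⟨z, hz, hmax⟩ := hc.exists_isMaxOn hne (omL w).continuous.continuousOn
    obtain ⟨x, hx⟩ := hcomp.extremePoints_nonempty ⟨z, hz, fun y hy => hmax hy⟩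
    refine ⟨x, hex.isExtreme.extremePoints_subset_extremePoints hx, ?_⟩
    intro p hp
    rw [map_sub]
    linarith [hx.1.2 p hp]
  · intro x hx y hy hxy
    simp only [Finite.coe_toFinset] at hx hy
    refine measure_mono_null (t := {w | omL (x - y) w = 0}) ?_
      (null_ker _ (omL_ne_zero (sub_ne_zero.2 hxy)))
    rintro w ⟨⟨h1, _⟩, ⟨h2, _⟩⟩
    have a1 := h1 y hy.1
    have a2 := h2 x hx.1
    have : omL w (y - x) = - omL w (x - y) := by rw [← map_neg, neg_sub]
    rw [mem_ofPred_eq, omL_symm]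
    linarith
  · intro x _
    exact ((ncone_measurable P x).inter hB).nullMeasurableSet

lemma uniform_bounds {T : Set (Set E2)} (hT : IsTiling T) (hmc : MonocoronalC T) {x0 : E2}
    (hx0 : IsVertex T x0) (hfin : {P | P ∈ T ∧ x0 ∈ P}.Finite) :
    ∃ ρ D : ℝ, 0 < ρ ∧ 0 < D ∧ ∀ P ∈ T, (∃ c, Metric.ball c ρ ⊆ P) ∧
      ∀ y ∈ extremePoints ℝ P, P ⊆ Metric.closedBall y D := by
  obtain ⟨_, hpoly, _, _⟩ := hT
  have hr : ∀ Q : Set E2, ∃ r : ℝ, 0 < r ∧ (Q ∈ T → ∃ c, Metric.ball c r ⊆ Q) := by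
    intro Q
    by_cases hQ : Q ∈ T
    · obtain ⟨c, hc⟩ := (hpoly Q hQ).2.2.1
      obtain ⟨r, hr, h⟩ := Metric.isOpen_iff.1 isOpen_interior c hc
      exact ⟨r, hr, fun _ => ⟨c, h.trans interior_subset⟩⟩
    · exact ⟨1, one_pos, fun h => absurd h hQ⟩
  choose r hr0 hr using hr
  obtain ⟨P0, hP0, hP0x⟩ := hx0
  have hne : hfin.toFinset.Nonempty := ⟨P0, by simpa using ⟨hP0, hP0x.1⟩⟩
  obtain ⟨Q0, hQ0, hmin⟩ := hfin.toFinset.exists_min_image r hne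
  have hbd : Bornology.IsBounded (⋃ Q ∈ {P | P ∈ T ∧ x0 ∈ P}, Q) := by
    rw [Bornology.isBounded_biUnion hfin]
    intro Q hQ
    exact (hpoly Q hQ.1).1.isBounded
  obtain ⟨D, hD0, hD⟩ := hbd.subset_closedBall_lt 0 x0
  have hmain : ∀ P ∈ T, ∀ y ∈ extremePoints ℝ P, ∃ (f : E2 ≃ᵃⁱ[ℝ] E2) (Q : Set E2),
      f x0 = y ∧ Q ∈ T ∧ x0 ∈ Q ∧ f '' Q = P := by
    intro P hP y hy
    obtain ⟨f, hfx, hf⟩ := hmc x0 y ⟨P0, hP0, hP0x⟩ ⟨P, hP, hy⟩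
    have : P ∈ {P | P ∈ T ∧ y ∈ P} := ⟨hP, hy.1⟩
    rw [← hf] at this
    obtain ⟨Q, ⟨hQ, hQx⟩, he⟩ := this
    exact ⟨f, Q, hfx, hQ, hQx, he⟩
  refine ⟨r Q0, D, hr0 Q0, hD0, fun P hP => ⟨?_, ?_⟩⟩
  · have hPne : P.Nonempty := (hpoly P hP).2.2.1.mono interior_subset
    obtain ⟨y, hy⟩ := (hpoly P hP).1.extremePoints_nonempty hPne
    obtain ⟨f, Q, hfx, hQ, hQx, rfl⟩ := hmain P hP y hy
    obtain ⟨c, hc⟩ := hr Q hQ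
    refine ⟨f c, ?_⟩
    have h1 : Metric.ball c (r Q0) ⊆ Q :=
      (Metric.ball_subset_ball (hmin Q (by simpa using ⟨hQ, hQx⟩))).trans hc
    intro z hz
    refine ⟨f.symm z, h1 ?_, by simp⟩
    rw [Metric.mem_ball] at hz ⊢
    rw [← f.dist_map]
    simpa using hz
  · intro y hy
    obtain ⟨f, Q, hfx, hQ, hQx, rfl⟩ := hmain P hP y hy
    rintro _ ⟨q, hq, rfl⟩
    have := hD (mem_biUnion (show Q ∈ {P | P ∈ T ∧ x0 ∈ P} from ⟨hQ, hQx⟩) hq)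
    rw [Metric.mem_closedBall] at this ⊢
    rw [← hfx, f.dist_map]
    exact this

lemma packing {T : Set (Set E2)} (hT : IsTiling T) {ρ : ℝ} (hρ : 0 < ρ)
    (hb : ∀ P ∈ T, ∃ c, Metric.ball c ρ ⊆ P) (F : Finset (Set E2)) (hF : ∀ P ∈ F, P ∈ T)
    {R : ℝ} (hR : 0 ≤ R) (hFR : ∀ P ∈ F, P ⊆ Metric.ball 0 R) :
    (F.card : ℝ) * ρ ^ 2 ≤ R ^ 2 := by
  have hb' : ∀ P : Set E2, ∃ c, P ∈ T → Metric.ball c ρ ⊆ P := by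
    intro P
    by_cases h : P ∈ T
    · obtain ⟨c, hc⟩ := hb P h
      exact ⟨c, fun _ => hc⟩
    · exact ⟨0, fun h' => absurd h' h⟩
  choose c hc using hb'
  have hball : ∀ (z : E2) {s : ℝ}, 0 ≤ s → (volume : Measure E2).real (Metric.ball z s)
      = s ^ 2 * (volume : Measure E2).real uB := by
    intro z s hs
    simp only [Measure.real]
    rw [Measure.addHaar_ball _ _ hs, ENNReal.toReal_mul, ENNReal.toReal_ofReal (by positivity)]
    simp [uB]
  have h1 := measureReal_biUnion_finset (μ := (volume : Measure E2)) (s := F)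
    (f := fun P => Metric.ball (c P) ρ) (by
      intro P hP Q hQ hPQ
      have := hT.2.2.2 (hF P hP) (hF Q hQ) hPQ
      exact this.mono (interior_maximal (hc P (hF P hP)) Metric.isOpen_ball)
        (interior_maximal (hc Q (hF Q hQ)) Metric.isOpen_ball))
    (fun _ _ => measurableSet_ball) (fun _ _ => measure_ball_lt_top.ne)
  have h2 : (volume : Measure E2).real (⋃ P ∈ F, Metric.ball (c P) ρ)
      ≤ (volume : Measure E2).real (Metric.ball (0 : E2) R) := by
    refine measureReal_mono ?_ measure_ball_lt_top.ne
    exact iUnion₂_subset fun P hP => (hc P (hF P hP)).trans (hFR P hP)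
  rw [h1, hball _ hR, Finset.sum_congr rfl (fun P _ => hball (c P) hρ.le), Finset.sum_const,
    nsmul_eq_mul, ← mul_assoc] at h2
  exact le_of_mul_le_mul_right h2 uB_pos

lemma locally_finite {T : Set (Set E2)} (hT : IsTiling T) {ρ D : ℝ} (hρ : 0 < ρ) (hD : 0 < D)
    (hb : ∀ P ∈ T, (∃ c, Metric.ball c ρ ⊆ P) ∧
      ∀ y ∈ extremePoints ℝ P, P ⊆ Metric.closedBall y D) {R : ℝ} (hR : 0 ≤ R) :
    ∃ F : Finset (Set E2), (∀ P, P ∈ F ↔ P ∈ T ∧ (P ∩ Metric.ball 0 R).Nonempty) ∧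
      (F.card : ℝ) * ρ ^ 2 ≤ (R + 2 * D) ^ 2 := by
  have hsub : ∀ P ∈ {P | P ∈ T ∧ (P ∩ Metric.ball (0 : E2) R).Nonempty},
      P ⊆ Metric.ball 0 (R + 2 * D) := by
    rintro P ⟨hP, p, hp, hpR⟩ z hz
    have hPP := hT.2.1 P hP
    obtain ⟨y, hy⟩ := hPP.1.extremePoints_nonempty ⟨p, hp⟩
    have h1 := (hb P hP).2 y hy hp
    have h2 := (hb P hP).2 y hy hz
    rw [Metric.mem_closedBall] at h1 h2
    rw [Metric.mem_ball] at hpR ⊢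
    have h3 := dist_triangle z y 0
    have h4 := dist_triangle y p 0
    rw [dist_comm y p] at h4
    linarith
  have hcard : ∀ F : Finset (Set E2),
      (F : Set (Set E2)) ⊆ {P | P ∈ T ∧ (P ∩ Metric.ball (0 : E2) R).Nonempty} →
      (F.card : ℝ) * ρ ^ 2 ≤ (R + 2 * D) ^ 2 := by
    intro F hF
    exact packing hT hρ (fun P hP => (hb P hP).1) F (fun P hP => (hF hP).1) (by positivity)
      (fun P hP => hsub P (hF hP))
  have hfin : {P | P ∈ T ∧ (P ∩ Metric.ball (0 : E2) R).Nonempty}.Finite := by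
    by_contra hinf
    obtain ⟨m, hm⟩ := exists_nat_gt ((R + 2 * D) ^ 2 / ρ ^ 2)
    obtain ⟨F, hF, hFc⟩ := Set.Infinite.exists_subset_card_eq hinf m
    have := hcard F hF
    rw [hFc, ← le_div_iff₀ (by positivity)] at this
    linarith
  exact ⟨hfin.toFinset, fun P => by simp, hcard _ (by simp)⟩

lemma full_angle {T : Set (Set E2)} (hT : IsTiling T) {ρ D : ℝ} (hρ : 0 < ρ) (hD : 0 < D)
    (hb : ∀ P ∈ T, (∃ c, Metric.ball c ρ ⊆ P) ∧
      ∀ y ∈ extremePoints ℝ P, P ⊆ Metric.closedBall y D) {x : E2}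
    (hfin : {P | P ∈ T ∧ x ∈ P}.Finite) :
    ∑ P ∈ hfin.toFinset, (volume : Measure E2).real (tcone P x ∩ uB)
      = (volume : Measure E2).real uB := by
  have hB : MeasurableSet uB := measurableSet_ball
  rw [← measureReal_biUnion_finset₀ (μ := (volume : Measure E2)) (s := hfin.toFinset)
    (f := fun P => tcone P x ∩ uB) (h := fun _ _ => uB_fin _)]
  · congr 1
    rw [← iUnion₂_inter, inter_eq_right]
    intro v _
    simp only [mem_iUnion, Finite.mem_toFinset, exists_prop]
    obtain ⟨F, hF, _⟩ := locally_finite hT hρ hD hb (R := ‖x‖ + 1) (by positivity)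
    classical
    have hcl : IsClosed (⋃ P ∈ F.filter (fun P => x ∉ P), P) := by
      apply Set.Finite.isClosed_biUnion (Finset.finite_toSet _)
      intro P hP
      simp only [Finset.coe_filter, mem_ofPred_eq] at hP
      exact (hT.2.1 P ((hF P).1 hP.1).1).1.isClosed
    have hxn : x ∈ (⋃ P ∈ F.filter (fun P => x ∉ P), P)ᶜ := by
      simp only [mem_compl_iff, mem_iUnion, not_exists]
      intro P hP h
      exact (Finset.mem_filter.1 hP).2 h
    have hc : Filter.Tendsto (fun t : ℝ => x + t • v) (nhdsWithin 0 (Ioi 0)) (nhds x) := by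
      have : Continuous (fun t : ℝ => x + t • v) := by fun_prop
      have h := this.tendsto 0
      simp only [zero_smul, add_zero] at h
      exact h.mono_left nhdsWithin_le_nhds
    have e1 := hc.eventually (hcl.isOpen_compl.mem_nhds hxn)
    have e2 := hc.eventually (Metric.isOpen_ball.mem_nhds
      (show x ∈ Metric.ball (0 : E2) (‖x‖ + 1) by simp))
    obtain ⟨t, ⟨h1, h2⟩, h3⟩ := ((e1.and e2).and self_mem_nhdsWithin).exists
    have : x + t • v ∈ ⋃₀ T := by rw [hT.2.2.1]; trivial
    obtain ⟨P, hP, hPx⟩ := this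
    refine ⟨P, ⟨hP, ?_⟩, ⟨t, h3, hPx⟩⟩
    by_contra hxP
    apply h1
    refine mem_biUnion (x := P) ?_ hPx
    exact Finset.mem_filter.2 ⟨(hF P).2 ⟨hP, _, hPx, h2⟩, hxP⟩
  · intro P hP Q hQ hPQ
    simp only [Finite.coe_toFinset] at hP hQ
    refine measure_mono_null (t := tcone P x ∩ tcone Q x) ?_
      (tcone_null_inter (hT.2.1 P hP.1).2.1 (hT.2.1 Q hQ.1).2.1 (hT.2.2.2 hP.1 hQ.1 hPQ) hP.2 hQ.2)
    rintro w ⟨⟨h1, _⟩, ⟨h2, _⟩⟩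
    exact ⟨h1, h2⟩
  · intro P hP
    have hP' : P ∈ T ∧ x ∈ P := by simpa using hP
    have hPP := hT.2.1 P hP'.1
    exact ((tcone_measurable hPP.2.1 hPP.1.isClosed hP'.2).inter hB).nullMeasurableSet

lemma vertex_exterior {T : Set (Set E2)} (hT : IsTiling T) {ρ D : ℝ} (hρ : 0 < ρ) (hD : 0 < D)
    (hb : ∀ P ∈ T, (∃ c, Metric.ball c ρ ⊆ P) ∧
      ∀ y ∈ extremePoints ℝ P, P ⊆ Metric.closedBall y D) {x : E2} {n : ℕ}
    (hfinC : {P | P ∈ T ∧ x ∈ P}.Finite)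
    (hfinV : {P | P ∈ T ∧ x ∈ extremePoints ℝ P}.Finite)
    (hC : hfinC.toFinset.card = n + 1) (hV : hfinV.toFinset.card = n)
    (hfr : ∀ P ∈ T, x ∈ P → x ∉ extremePoints ℝ P → x ∈ frontier P) :
    ∑ P ∈ hfinV.toFinset, (volume : Measure E2).real (ncone P x ∩ uB)
      = ((n : ℝ) - 1) / 2 * (volume : Measure E2).real uB := by
  classical
  have hsum := full_angle hT hρ hD hb hfinC
  have hsub : hfinV.toFinset ⊆ hfinC.toFinset := by
    intro P hP
    simp only [Finite.mem_toFinset, mem_ofPred_eq] at hP ⊢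
    exact ⟨hP.1, hP.2.1⟩
  rw [← Finset.sum_sdiff hsub] at hsum
  have h1 : ∑ P ∈ hfinC.toFinset \ hfinV.toFinset, (volume : Measure E2).real (tcone P x ∩ uB)
      = (volume : Measure E2).real uB / 2 := by
    rw [Finset.sum_congr rfl (g := fun _ => (volume : Measure E2).real uB / 2),
      Finset.sum_const, Finset.card_sdiff_of_subset hsub, hC, hV]
    · simp
    · intro P hP
      simp only [Finset.mem_sdiff, Finite.mem_toFinset, mem_ofPred_eq, not_and] at hP
      obtain ⟨⟨hPT, hxP⟩, hne⟩ := hP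
      have hPP := hT.2.1 P hPT
      exact straight_angle hPP.2.1 hPP.1.isClosed hPP.2.2.1 hxP (hne hPT)
        (hfr P hPT hxP (hne hPT))
  have h2 : ∑ P ∈ hfinV.toFinset, (volume : Measure E2).real (tcone P x ∩ uB)
      + ∑ P ∈ hfinV.toFinset, (volume : Measure E2).real (ncone P x ∩ uB)
      = n * ((volume : Measure E2).real uB / 2) := by
    rw [← Finset.sum_add_distrib, Finset.sum_congr rfl
      (g := fun _ => (volume : Measure E2).real uB / 2), Finset.sum_const, hV, nsmul_eq_mul]
    intro P hP
    simp only [Finite.mem_toFinset, mem_ofPred_eq] at hP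
    have hPP := hT.2.1 P hP.1
    exact extreme_angle hPP.2.1 hPP.1.isClosed hPP.2.2.1 hP.2
  linarith

/-- A sequence growing at least geometrically is not quadratically bounded. -/
lemma growth {v : ℕ → ℝ} {δ A B : ℝ} (hδ : 0 < δ) {k0 : ℕ} (hk0 : 1 ≤ v k0)
    (hstep : ∀ k, δ * v k ≤ v (k + 1) - v k)
    (hbd : ∀ k, v k ≤ A * ((k : ℝ) + B) ^ 2) : False := by
  have h1 : ∀ k, (1 + δ) ^ k ≤ v (k + k0) := by
    intro k
    induction k with
    | zero => simpa using hk0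
    | succ k ih =>
      have := hstep (k + k0)
      have e : k + 1 + k0 = k + k0 + 1 := by ring
      rw [e, pow_succ]
      nlinarith
  have h2 : Filter.Tendsto (fun k : ℕ => (k : ℝ) ^ 2 / (1 + δ) ^ k) Filter.atTop (nhds 0) :=
    tendsto_pow_const_div_const_pow_of_one_lt 2 (by linarith)
  set C := |A| * (1 + |(k0 : ℝ) + B|) ^ 2 with hC
  have hCpos : 0 ≤ C := by positivity
  have h3 : ∀ᶠ k : ℕ in Filter.atTop, (k : ℝ) ^ 2 / (1 + δ) ^ k < 1 / (C + 1) :=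
    h2.eventually (gt_mem_nhds (by positivity))
  obtain ⟨k, hk, hk1⟩ := (h3.and (Filter.eventually_ge_atTop 1)).exists
  have hk1' : (1 : ℝ) ≤ k := by exact_mod_cast hk1
  rw [div_lt_div_iff₀ (by positivity) (by positivity)] at hk
  have h4 := (h1 k).trans (hbd (k + k0))
  push_cast at h4
  have h5 : A * ((k : ℝ) + k0 + B) ^ 2 ≤ C * k ^ 2 := by
    have h6 : |(k : ℝ) + k0 + B| ≤ (1 + |(k0 : ℝ) + B|) * k := by
      have := abs_add_le (k : ℝ) (k0 + B)
      rw [← add_assoc] at this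
      rw [abs_of_nonneg (by positivity : (0 : ℝ) ≤ k)] at this
      nlinarith [abs_nonneg ((k0 : ℝ) + B)]
    calc A * ((k : ℝ) + k0 + B) ^ 2 ≤ |A| * ((k : ℝ) + k0 + B) ^ 2 := by
          gcongr; exact le_abs_self A
      _ = |A| * |(k : ℝ) + k0 + B| ^ 2 := by rw [sq_abs]
      _ ≤ |A| * ((1 + |(k0 : ℝ) + B|) * k) ^ 2 := by gcongr
      _ = C * k ^ 2 := by rw [hC]; ring
  nlinarith [sq_nonneg (k : ℝ)]

/-- In a monocoronal non-face-to-face tiling in which every vertex `x` lies in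
exactly `n + 1` tiles, is an extreme point of exactly `n` of them, with numbers of
extreme points `a 0, …, a (n-1)`, and lies on the boundary of the remaining tile
without being one of its extreme points, one has `∑ 1 / a i = (n - 1) / 2`. -/
theorem monocoronal_nonFaceToFace_angle_equation (T : Set (Set E2)) (hT : IsTiling T)
    (hmc : MonocoronalC T)
    (n : ℕ) (hn : 1 ≤ n) (a : Fin n → ℕ) (ha : ∀ i, 3 ≤ a i)
    (hcor : ∀ x : E2, IsVertex T x →
      ∃ (hfinC : {P | P ∈ T ∧ x ∈ P}.Finite)
        (hfinV : {P | P ∈ T ∧ x ∈ Set.extremePoints ℝ P}.Finite),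
        hfinC.toFinset.card = n + 1 ∧
        hfinV.toFinset.card = n ∧
        hfinV.toFinset.val.map (fun P => (Set.extremePoints ℝ P).ncard) =
          (Finset.univ.val : Multiset (Fin n)).map (fun i => a i) ∧
        ∀ P ∈ T, x ∈ P → x ∉ Set.extremePoints ℝ P →
          x ∈ frontier P) :
    ∑ i : Fin n, (1 : ℝ) / (a i : ℝ) = ((n : ℝ) - 1) / 2 := by
  classical
  by_contra hne
  set S := ∑ i : Fin n, (1 : ℝ) / (a i : ℝ) with hS
  have hpoly := hT.2.1
  -- a base vertex
  obtain ⟨P0, hP0, -⟩ : (0 : E2) ∈ ⋃₀ T := by rw [hT.2.2.1]; trivial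
  have hextne : ∀ P ∈ T, (extremePoints ℝ P).Nonempty := fun P hP =>
    (hpoly P hP).1.extremePoints_nonempty ((hpoly P hP).2.2.1.mono interior_subset)
  obtain ⟨x0, hx0⟩ := hextne P0 hP0
  have hx0v : IsVertex T x0 := ⟨P0, hP0, hx0⟩
  obtain ⟨ρ, D, hρ, hD, hb⟩ := uniform_bounds hT hmc hx0v (hcor x0 hx0v).choose
  -- numbers of extreme points are bounded
  have hN : ∀ P ∈ T, (extremePoints ℝ P).ncard ≤ ∑ i, a i := by
    intro P hP
    obtain ⟨y, hy⟩ := hextne P hP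
    obtain ⟨hfC, hfV, -, -, hmul, -⟩ := hcor y ⟨P, hP, hy⟩
    have h1 : (extremePoints ℝ P).ncard ∈
        hfV.toFinset.val.map (fun P => (Set.extremePoints ℝ P).ncard) :=
      Multiset.mem_map.2 ⟨P, by simpa using ⟨hP, hy⟩, rfl⟩
    rw [hmul] at h1
    obtain ⟨i, -, hi⟩ := Multiset.mem_map.1 h1
    rw [← hi]
    exact Finset.single_le_sum (f := a) (fun _ _ => Nat.zero_le _) (Finset.mem_univ i)
  set vB := (volume : Measure E2).real uB with hvB
  have hvBpos : 0 < vB := uB_pos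
  set g : Set E2 → E2 → ℝ := fun P x =>
    (volume : Measure E2).real (ncone P x ∩ uB) / vB - 1 / ((extremePoints ℝ P).ncard : ℝ) with hg
  have hgle : ∀ P x, |g P x| ≤ 1 := by
    intro P x
    have h1 : (volume : Measure E2).real (ncone P x ∩ uB) / vB ≤ 1 := by
      rw [div_le_one hvBpos]
      exact measureReal_mono inter_subset_right measure_ball_lt_top.ne
    have h2 : 0 ≤ (volume : Measure E2).real (ncone P x ∩ uB) / vB := by positivity
    have h3 : 1 / ((extremePoints ℝ P).ncard : ℝ) ≤ 1 := by
      rw [one_div]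
      exact Nat.cast_inv_le_one _
    have h4 : 0 ≤ 1 / ((extremePoints ℝ P).ncard : ℝ) := by positivity
    rw [abs_le]
    constructor <;> simp only [hg] <;> linarith
  have hgP : ∀ P ∈ T, ∀ h : (extremePoints ℝ P).Finite, ∑ x ∈ h.toFinset, g P x = 0 := by
    intro P hP h
    have hPP := hpoly P hP
    have h1 := exterior_angle_sum hPP.1 (hPP.2.2.1.mono interior_subset) h
    simp only [hg]
    rw [Finset.sum_sub_distrib, ← Finset.sum_div, h1, Finset.sum_const,
      ← Set.ncard_eq_toFinset_card _ h, nsmul_eq_mul, div_self hvBpos.ne']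
    have h2 : ((extremePoints ℝ P).ncard : ℝ) ≠ 0 := by
      have := (Set.ncard_pos h).2 (hextne P hP)
      positivity
    field_simp
    ring
  have hgx : ∀ x, IsVertex T x → ∃ hfV : {P | P ∈ T ∧ x ∈ Set.extremePoints ℝ P}.Finite,
      hfV.toFinset.card = n ∧ ∑ P ∈ hfV.toFinset, g P x = ((n : ℝ) - 1) / 2 - S := by
    intro x hx
    obtain ⟨hfC, hfV, hC, hV, hmul, hfr⟩ := hcor x hx
    refine ⟨hfV, hV, ?_⟩
    have h1 := vertex_exterior hT hρ hD hb hfC hfV hC hV hfr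
    have h2 : ∑ P ∈ hfV.toFinset, 1 / ((extremePoints ℝ P).ncard : ℝ) = S := by
      have := congrArg (fun m => (m.map (fun k : ℕ => 1 / (k : ℝ))).sum) hmul
      simp only [Multiset.map_map] at this
      exact this
    simp only [hg]
    rw [Finset.sum_sub_distrib, ← Finset.sum_div, h1, h2, mul_div_cancel_right₀ _ hvBpos.ne']
  set K := ((n : ℝ) - 1) / 2 - S with hK
  have hK0 : K ≠ 0 := fun h => hne (by linarith)
  -- vertices in balls
  have hVex : ∀ k : ℕ, ∃ V : Finset E2,
      (∀ x, x ∈ V ↔ IsVertex T x ∧ x ∈ Metric.ball (0 : E2) (k * D)) ∧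
      ((V.card : ℝ) ≤ (((∑ i, a i : ℕ) : ℝ) * D ^ 2 / ρ ^ 2) * ((k : ℝ) + 2) ^ 2) ∧
      ∃ Tl : Finset (Set E2), ∀ P, P ∈ Tl ↔ P ∈ T ∧ ∃ x ∈ V, x ∈ extremePoints ℝ P := by
    intro k
    obtain ⟨F, hF, hFc⟩ := locally_finite hT hρ hD hb (R := k * D) (by positivity)
    have hext : ∀ P ∈ F, (extremePoints ℝ P).Finite := fun P hP =>
      (hpoly P ((hF P).1 hP).1).2.2.2
    set W : Finset E2 := F.attach.biUnion (fun P => (hext P.1 P.2).toFinset) with hW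
    have hmemW : ∀ x, x ∈ W ↔ ∃ P ∈ F, x ∈ extremePoints ℝ P := by
      intro x
      simp [hW]
    have hWc : W.card ≤ F.card * ∑ i, a i := by
      refine (Finset.card_biUnion_le_card_mul _ _ (∑ i, a i) ?_).trans (by simp)
      intro P _
      rw [← Set.ncard_eq_toFinset_card _ (hext P.1 P.2)]
      exact hN P.1 ((hF P.1).1 P.2).1
    have hVmem : ∀ x, x ∈ W.filter (fun x => x ∈ Metric.ball (0 : E2) (k * D)) ↔
        IsVertex T x ∧ x ∈ Metric.ball (0 : E2) (k * D) := by
      intro x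
      rw [Finset.mem_filter, hmemW]
      constructor
      · rintro ⟨⟨P, hP, hx⟩, h⟩
        exact ⟨⟨P, ((hF P).1 hP).1, hx⟩, h⟩
      · rintro ⟨⟨P, hP, hx⟩, h⟩
        exact ⟨⟨P, (hF P).2 ⟨hP, x, hx.1, h⟩, hx⟩, h⟩
    refine ⟨W.filter (fun x => x ∈ Metric.ball (0 : E2) (k * D)), hVmem, ?_,
      F.filter (fun P => ∃ x ∈ W.filter (fun x => x ∈ Metric.ball (0 : E2) (k * D)),
        x ∈ extremePoints ℝ P), ?_⟩
    · have h1 : ((W.filter (fun x => x ∈ Metric.ball (0 : E2) (k * D))).card : ℝ)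
          ≤ F.card * ((∑ i, a i : ℕ) : ℝ) := by
        exact_mod_cast (Finset.card_filter_le _ _).trans hWc
      have h2 : (F.card : ℝ) ≤ (k * D + 2 * D) ^ 2 / ρ ^ 2 := by
        rwa [le_div_iff₀ (by positivity)]
      calc _ ≤ _ := h1
        _ ≤ (k * D + 2 * D) ^ 2 / ρ ^ 2 * ((∑ i, a i : ℕ) : ℝ) := by gcongr
        _ = _ := by ring
    · intro P
      rw [Finset.mem_filter]
      constructor
      · rintro ⟨hP, h⟩
        exact ⟨((hF P).1 hP).1, h⟩
      · rintro ⟨hP, x, hx, h⟩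
        exact ⟨(hF P).2 ⟨hP, x, h.1, ((hVmem x).1 hx).2⟩, x, hx, h⟩
  choose V hV hVc Tl hTl using hVex
  have hsub : ∀ k, V k ⊆ V (k + 1) := by
    intro k x hx
    rw [hV] at hx ⊢
    refine ⟨hx.1, Metric.ball_subset_ball ?_ hx.2⟩
    push_cast
    nlinarith
  have hstep : ∀ k, |K| * ((V k).card : ℝ) ≤ n * (((V (k + 1)).card : ℝ) - (V k).card) := by
    intro k
    have hzero : ∑ P ∈ Tl k, ∑ x ∈ V (k + 1), (if x ∈ extremePoints ℝ P then g P x else 0) = 0 := by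
      apply Finset.sum_eq_zero
      intro P hP
      obtain ⟨hPT, x, hx, hxP⟩ := (hTl k P).1 hP
      have hfin := (hpoly P hPT).2.2.2
      rw [← Finset.sum_filter, ← hgP P hPT hfin]
      apply Finset.sum_congr _ (fun _ _ => rfl)
      ext y
      rw [Finset.mem_filter, Finite.mem_toFinset, hV]
      constructor
      · exact fun h => h.2
      · intro hy
        refine ⟨⟨⟨P, hPT, hy⟩, ?_⟩, hy⟩
        have h1 := (hb P hPT).2 x hxP hy.1
        have h2 := ((hV k x).1 hx).2
        rw [Metric.mem_closedBall] at h1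
        rw [Metric.mem_ball] at h2 ⊢
        have := dist_triangle y x 0
        push_cast
        linarith
    rw [Finset.sum_comm, ← Finset.sum_sdiff (hsub k)] at hzero
    have hin : ∑ x ∈ V k, ∑ P ∈ Tl k, (if x ∈ extremePoints ℝ P then g P x else 0)
        = (V k).card * K := by
      rw [← nsmul_eq_mul, ← Finset.sum_const]
      apply Finset.sum_congr rfl
      intro x hx
      obtain ⟨hfV, -, hsum⟩ := hgx x ((hV k x).1 hx).1
      rw [← Finset.sum_filter, ← hsum]
      apply Finset.sum_congr _ (fun _ _ => rfl)
      ext P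
      rw [Finset.mem_filter, Finite.mem_toFinset, hTl]
      constructor
      · exact fun h => ⟨h.1.1, h.2⟩
      · exact fun h => ⟨⟨h.1, x, hx, h.2⟩, h.2⟩
    have hout : |∑ x ∈ V (k + 1) \ V k,
        ∑ P ∈ Tl k, (if x ∈ extremePoints ℝ P then g P x else 0)|
        ≤ n * (((V (k + 1)).card : ℝ) - (V k).card) := by
      have hc : (((V (k + 1)).card : ℝ) - (V k).card) = ((V (k + 1) \ V k).card : ℝ) := by
        rw [Finset.card_sdiff_of_subset (hsub k), Nat.cast_sub (Finset.card_le_card (hsub k))]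
      rw [hc, mul_comm, ← nsmul_eq_mul, ← Finset.sum_const]
      refine (Finset.abs_sum_le_sum_abs _ _).trans (Finset.sum_le_sum ?_)
      intro x hx
      have hxV := (Finset.mem_sdiff.1 hx).1
      obtain ⟨hfV, hcard, -⟩ := hgx x ((hV (k + 1) x).1 hxV).1
      rw [← Finset.sum_filter]
      refine (Finset.abs_sum_le_sum_abs _ _).trans ?_
      refine (Finset.sum_le_sum (fun P _ => hgle P x)).trans ?_
      rw [Finset.sum_const, nsmul_eq_mul, mul_one, ← hcard]
      norm_cast
      apply Finset.card_le_card
      intro P hP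
      rw [Finset.mem_filter, hTl] at hP
      rw [Finite.mem_toFinset]
      exact ⟨hP.1.1, hP.2⟩
    rw [hin] at hzero
    have : |((V k).card : ℝ) * K| ≤ n * (((V (k + 1)).card : ℝ) - (V k).card) := by
      have e : ((V k).card : ℝ) * K = -(∑ x ∈ V (k + 1) \ V k,
        ∑ P ∈ Tl k, (if x ∈ extremePoints ℝ P then g P x else 0)) := by linarith
      rw [e, abs_neg]
      exact hout
    rw [abs_mul, abs_of_nonneg (by positivity : (0 : ℝ) ≤ (V k).card)] at this
    linarith
  have hn0 : (0 : ℝ) < n := by exact_mod_cast hn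
  obtain ⟨k0, hk0⟩ := exists_nat_gt (dist x0 0 / D)
  refine growth (v := fun k => ((V k).card : ℝ)) (δ := |K| / n) (k0 := k0)
    (div_pos (abs_pos.2 hK0) hn0) ?_ ?_ hVc
  · have : x0 ∈ V k0 := by
      rw [hV]
      refine ⟨hx0v, ?_⟩
      rw [Metric.mem_ball]
      rwa [div_lt_iff₀ hD] at hk0
    exact_mod_cast Finset.card_pos.2 ⟨x0, this⟩
  · intro k
    have := hstep k
    rw [div_mul_eq_mul_div, div_le_iff₀ hn0]
    linarith
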